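/- arXiv:2511.23015 — 3 statements merged into one kernel-verified Lean document; each statement's English description precedes it below -/
import Mathlib

section
/- The coefficient operator of the discrete temperature wave equation is symmetric and positive definite: let Δt > 0 and let d : (ZMod N) × (ZMod M) → ℝ be a cell function with d(c) > 0 for every cell c (in the scheme, d(c) = (1 + Δt/τ₂) c_v/(Tⁿ(c) c_h²)). Define the linear map L on cell functions by (L T)(c) = d(c)·T(c) − Δt²·(D_x(G_x T)(c) + D_y(G_y T)(c)). Then (i) L is self-adjoint for the ℓ² inner product: ∑_c (L T)(c)·S(c) = ∑_c T(c)·(L S)(c) for all cell functions T, S, and (ii) L is positive definite: ∑_c (L T)(c)·T(c) > 0 for every cell function T that is not identically zero. -/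
variable {N M : ℕ}

/-- Cell-to-vertex gradient in the x-direction on the periodic staggered grid. -/
noncomputable def Gx (dx : ℝ) (φ : ZMod N × ZMod M → ℝ) : ZMod N × ZMod M → ℝ :=
  fun q => (φ (q.1, q.2) + φ (q.1, q.2 - 1) - φ (q.1 - 1, q.2) - φ (q.1 - 1, q.2 - 1)) / (2 * dx)

/-- Cell-to-vertex gradient in the y-direction on the periodic staggered grid. -/
noncomputable def Gy (dy : ℝ) (φ : ZMod N × ZMod M → ℝ) : ZMod N × ZMod M → ℝ :=
  fun q => (φ (q.1, q.2) + φ (q.1 - 1, q.2) - φ (q.1, q.2 - 1) - φ (q.1 - 1, q.2 - 1)) / (2 * dy)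

/-- Vertex-to-cell gradient in the x-direction on the periodic staggered grid. -/
noncomputable def Dx (dx : ℝ) (ψ : ZMod N × ZMod M → ℝ) : ZMod N × ZMod M → ℝ :=
  fun c => (ψ (c.1 + 1, c.2) + ψ (c.1 + 1, c.2 + 1) - ψ (c.1, c.2) - ψ (c.1, c.2 + 1)) / (2 * dx)

/-- Vertex-to-cell gradient in the y-direction on the periodic staggered grid. -/
noncomputable def Dy (dy : ℝ) (ψ : ZMod N × ZMod M → ℝ) : ZMod N × ZMod M → ℝ :=
  fun c => (ψ (c.1, c.2 + 1) + ψ (c.1 + 1, c.2 + 1) - ψ (c.1, c.2) - ψ (c.1 + 1, c.2)) / (2 * dy)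

/-- The coefficient operator of the discrete temperature wave equation,
(L T)(c) = d(c)·T(c) − Δt²·(D_x(G_x T)(c) + D_y(G_y T)(c)). -/
noncomputable def Lop (dx dy Δt : ℝ) (d : ZMod N × ZMod M → ℝ)
    (T : ZMod N × ZMod M → ℝ) : ZMod N × ZMod M → ℝ :=
  fun c => d c * T c - Δt ^ 2 * (Dx dx (Gx dx T) c + Dy dy (Gy dy T) c)

/-- Summation by parts for a translation of the periodic grid. -/
theorem sum_shift_mul [NeZero N] [NeZero M] (a : ZMod N) (b : ZMod M)
    (f g : ZMod N × ZMod M → ℝ) :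
    ∑ c, f (c.1 + a, c.2 + b) * g c = ∑ c, f c * g (c.1 - a, c.2 - b) := by
  rw [← Equiv.sum_comp (Equiv.addRight (a, b)) fun c => f c * g (c.1 - a, c.2 - b)]
  simp [Prod.add_def]

/-- The vertex-to-cell x-gradient is minus the adjoint of the cell-to-vertex x-gradient. -/
theorem sum_Dx_mul [NeZero N] [NeZero M] (dx : ℝ) (ψ S : ZMod N × ZMod M → ℝ) :
    ∑ c, Dx dx ψ c * S c = -∑ c, ψ c * Gx dx S c := by
  have h10 := sum_shift_mul 1 0 ψ S
  have h11 := sum_shift_mul 1 1 ψ S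
  have h01 := sum_shift_mul 0 1 ψ S
  simp only [add_zero, sub_zero] at h10 h01
  simp only [Dx, Gx, div_mul_eq_mul_div, mul_div_assoc', ← Finset.sum_div, add_mul, sub_mul,
    mul_add, mul_sub, Finset.sum_add_distrib, Finset.sum_sub_distrib, h10, h11, h01]
  ring

/-- The vertex-to-cell y-gradient is minus the adjoint of the cell-to-vertex y-gradient. -/
theorem sum_Dy_mul [NeZero N] [NeZero M] (dy : ℝ) (ψ S : ZMod N × ZMod M → ℝ) :
    ∑ c, Dy dy ψ c * S c = -∑ c, ψ c * Gy dy S c := by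
  have h10 := sum_shift_mul 1 0 ψ S
  have h11 := sum_shift_mul 1 1 ψ S
  have h01 := sum_shift_mul 0 1 ψ S
  simp only [add_zero, sub_zero] at h10 h01
  simp only [Dy, Gy, div_mul_eq_mul_div, mul_div_assoc', ← Finset.sum_div, add_mul, sub_mul,
    mul_add, mul_sub, Finset.sum_add_distrib, Finset.sum_sub_distrib, h10, h11, h01]
  ring

/-- The bilinear form of the temperature operator, with the gradients moved onto both arguments. -/
theorem sum_Lop_mul [NeZero N] [NeZero M] (dx dy Δt : ℝ) (d T S : ZMod N × ZMod M → ℝ) :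
    ∑ c, Lop dx dy Δt d T c * S c =
      ∑ c, (d c * (T c * S c) +
        Δt ^ 2 * (Gx dx T c * Gx dx S c + Gy dy T c * Gy dy S c)) := by
  have hx := sum_Dx_mul dx (Gx dx T) S
  have hy := sum_Dy_mul dy (Gy dy T) S
  simp only [Lop, sub_mul, mul_assoc, add_mul, Finset.sum_sub_distrib, Finset.sum_add_distrib,
    ← Finset.mul_sum, hx, hy]
  ring

/-- The coefficient operator of the discrete temperature wave equation is
self-adjoint for the ℓ² inner product and positive definite. -/
theorem temperature_operator_symmetric_posdef (N M : ℕ) [NeZero N] [NeZero M]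
    (dx dy : ℝ) (hdx : 0 < dx) (hdy : 0 < dy) (Δt : ℝ) (hΔt : 0 < Δt)
    (d : ZMod N × ZMod M → ℝ) (hd : ∀ c, 0 < d c) :
    (∀ T S : ZMod N × ZMod M → ℝ,
      ∑ c : ZMod N × ZMod M, Lop dx dy Δt d T c * S c =
      ∑ c : ZMod N × ZMod M, T c * Lop dx dy Δt d S c) ∧
    (∀ T : ZMod N × ZMod M → ℝ, T ≠ 0 →
      0 < ∑ c : ZMod N × ZMod M, Lop dx dy Δt d T c * T c) := by
  refine ⟨fun T S => ?_, fun T hT => ?_⟩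
  · simp_rw [mul_comm (T _) (Lop _ _ _ _ _ _), sum_Lop_mul, mul_comm (T _) (S _),
      mul_comm (Gx dx T _), mul_comm (Gy dy T _)]
  · rw [sum_Lop_mul]
    obtain ⟨c, hc⟩ := Function.ne_iff.mp hT
    refine Finset.sum_pos' (fun c _ => ?_) ⟨c, Finset.mem_univ c, ?_⟩
    · have := hd c
      have := mul_self_nonneg (T c)
      have := mul_self_nonneg (Gx dx T c)
      have := mul_self_nonneg (Gy dy T c)
      positivity
    · have := hd c
      have := mul_self_pos.mpr hc
      have := mul_self_nonneg (Gx dx T c)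
      have := mul_self_nonneg (Gy dy T c)
      positivity
end

section
/- Minkowski determinant inequality for 3×3 positive semidefinite real matrices: if A and B are positive semidefinite symmetric real 3×3 matrices, then det(A + B)^{1/3} ≥ det(A)^{1/3} + det(B)^{1/3}. -/
/-- The weighted geometric mean is superadditive. -/
theorem Real.prod_rpow_add_prod_rpow_le {ι : Type*} (s : Finset ι) {w x y : ι → ℝ}
    (hw : ∀ i ∈ s, 0 ≤ w i) (hw' : ∑ i ∈ s, w i = 1) (hx : ∀ i ∈ s, 0 ≤ x i)
    (hy : ∀ i ∈ s, 0 ≤ y i) (hxy : ∀ i ∈ s, 0 < x i + y i) :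
    ∏ i ∈ s, x i ^ w i + ∏ i ∈ s, y i ^ w i ≤ ∏ i ∈ s, (x i + y i) ^ w i := by
  have key : ∀ z : ι → ℝ, (∀ i ∈ s, 0 ≤ z i) →
      (∏ i ∈ s, z i ^ w i) / ∏ i ∈ s, (x i + y i) ^ w i ≤ ∑ i ∈ s, w i * (z i / (x i + y i)) := by
    intro z hz
    rw [← Finset.prod_div_distrib,
      Finset.prod_congr rfl fun i hi ↦ (Real.div_rpow (hz i hi) (hxy i hi).le (w i)).symm]
    exact Real.geom_mean_le_arith_mean_weighted s w _ hw hw'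
      fun i hi ↦ div_nonneg (hz i hi) (hxy i hi).le
  have hsum : ∑ i ∈ s, w i * (x i / (x i + y i)) + ∑ i ∈ s, w i * (y i / (x i + y i)) = 1 := by
    rw [← Finset.sum_add_distrib, ← hw']
    refine Finset.sum_congr rfl fun i hi ↦ ?_
    rw [← mul_add, ← add_div, div_self (hxy i hi).ne', mul_one]
  rw [← div_le_one (Finset.prod_pos fun i hi ↦ Real.rpow_pos_of_pos (hxy i hi) _), add_div, ← hsum]
  exact add_le_add (key x hx) (key y hy)

namespace Matrix

variable {n : Type*} [Fintype n] [DecidableEq n]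

theorem IsHermitian.det_one_add {A : Matrix n n ℝ} (hA : A.IsHermitian) :
    (1 + A).det = ∏ i, (1 + hA.eigenvalues i) := by
  have h := congrArg (Polynomial.eval (-1)) hA.charpoly_eq
  rw [eval_charpoly, Polynomial.eval_prod] at h
  have h1 : scalar n (-1 : ℝ) - A = -(1 + A) := by
    rw [map_neg, map_one]
    abel
  have h2 : ∀ i, (Polynomial.X - Polynomial.C (hA.eigenvalues i)).eval (-1) = -(1 + hA.eigenvalues i) := by
    intro i
    rw [Polynomial.eval_sub, Polynomial.eval_X, Polynomial.eval_C]
    ring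
  simp only [RCLike.ofReal_real_eq_id, id_eq, h1, h2, det_neg, Finset.prod_neg,
    Finset.card_univ] at h
  exact mul_left_cancel₀ (pow_ne_zero _ (by norm_num)) h

variable [Nonempty n]

theorem PosSemidef.one_add_det_rpow_le {A : Matrix n n ℝ} (hA : A.PosSemidef) :
    1 + A.det ^ (1 / (Fintype.card n : ℝ)) ≤ (1 + A).det ^ (1 / (Fintype.card n : ℝ)) := by
  have hnn := hA.eigenvalues_nonneg
  have hdet : A.det = ∏ i, hA.isHermitian.eigenvalues i :=
    hA.isHermitian.det_eq_prod_eigenvalues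
  rw [hA.isHermitian.det_one_add, hdet, ← Real.finsetProd_rpow _ _ fun i _ ↦ hnn i,
    ← Real.finsetProd_rpow _ _ fun i _ ↦ add_nonneg zero_le_one (hnn i)]
  simpa using Real.prod_rpow_add_prod_rpow_le Finset.univ
    (w := fun _ ↦ 1 / (Fintype.card n : ℝ)) (x := fun _ ↦ 1) (fun _ _ ↦ by positivity) (by simp)
    (fun _ _ ↦ zero_le_one) (fun i _ ↦ hnn i) fun i _ ↦ add_pos_of_pos_of_nonneg one_pos (hnn i)

open scoped MatrixOrder in
theorem PosSemidef.det_rpow_add_le_of_det_ne_zero {A B : Matrix n n ℝ} (hA : A.PosSemidef)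
    (hB : B.PosSemidef) (h : A.det ≠ 0) :
    A.det ^ (1 / (Fintype.card n : ℝ)) + B.det ^ (1 / (Fintype.card n : ℝ)) ≤
      (A + B).det ^ (1 / (Fintype.card n : ℝ)) := by
  obtain ⟨M, rfl⟩ := CStarAlgebra.nonneg_iff_eq_star_mul_self.mp hA.nonneg
  rw [star_eq_conjTranspose] at *
  have hM : IsUnit M.det := isUnit_iff_ne_zero.mpr fun h0 ↦ h (by rw [det_mul, h0, mul_zero])
  have hC : (M⁻¹ᴴ * B * M⁻¹).PosSemidef := hB.conjTranspose_mul_mul_same _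
  have hBC : B = Mᴴ * (M⁻¹ᴴ * B * M⁻¹) * M := by
    simp only [← Matrix.mul_assoc]
    rw [← conjTranspose_mul, nonsing_inv_mul _ hM, conjTranspose_one, Matrix.one_mul,
      Matrix.mul_assoc, nonsing_inv_mul _ hM, Matrix.mul_one]
  generalize M⁻¹ᴴ * B * M⁻¹ = C at hC hBC
  subst hBC
  have hdet : ∀ D : Matrix n n ℝ, (Mᴴ * D * M).det = (Mᴴ * M).det * D.det := by
    intro D
    simp only [det_mul]
    ring
  have hadd : Mᴴ * M + Mᴴ * C * M = Mᴴ * (1 + C) * M := by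
    rw [Matrix.mul_add, Matrix.mul_one, Matrix.add_mul]
  rw [hadd, hdet, hdet, Real.mul_rpow hA.det_nonneg hC.det_nonneg,
    Real.mul_rpow hA.det_nonneg (PosSemidef.one.add hC).det_nonneg, ← mul_one_add]
  exact mul_le_mul_of_nonneg_left hC.one_add_det_rpow_le (Real.rpow_nonneg hA.det_nonneg _)

/-- **Minkowski's determinant inequality**. -/
theorem PosSemidef.det_rpow_add_le {A B : Matrix n n ℝ} (hA : A.PosSemidef) (hB : B.PosSemidef) :
    A.det ^ (1 / (Fintype.card n : ℝ)) + B.det ^ (1 / (Fintype.card n : ℝ)) ≤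
      (A + B).det ^ (1 / (Fintype.card n : ℝ)) := by
  by_cases h : A.det = 0
  · by_cases h' : B.det = 0
    · rw [h, h', Real.zero_rpow (by positivity), add_zero]
      exact Real.rpow_nonneg (hA.add hB).det_nonneg _
    · rw [add_comm, add_comm A]
      exact hB.det_rpow_add_le_of_det_ne_zero hA h'
  · exact hA.det_rpow_add_le_of_det_ne_zero hB h

end Matrix


/-- Minkowski determinant inequality for 3×3 positive semidefinite real matrices:
det(A + B)^{1/3} ≥ det(A)^{1/3} + det(B)^{1/3}. -/
theorem minkowski_det_inequality (A B : Matrix (Fin 3) (Fin 3) ℝ)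
    (hA : A.PosSemidef) (hB : B.PosSemidef) :
    (A + B).det ^ ((1 : ℝ) / 3) ≥ A.det ^ ((1 : ℝ) / 3) + B.det ^ ((1 : ℝ) / 3) := by
  simpa using hA.det_rpow_add_le hB
end

section
/- Discrete Navier–Stokes stress tensor identity in the stiff viscous limit: let ρ > 0, ρ₀ > 0, c_s > 0, τ₁ > 0, Δt > 0 be real numbers, set g = (ρ/ρ₀)^{2/3}, let G = g•1 be the 3×3 matrix g times the identity, and let Σ̃⁻¹ = (τ₁/(6Δt))·g^{−5/2}•G⁻¹ (the stiff-limit approximation of Σ⁻¹, using det(G)^{−5/6} = g^{−5/2}). Then for all indices i, k, n, m ∈ Fin 3: Δt·ρ·c_s²·∑_{l,a} G i l · (Σ̃⁻¹) a l · ( G a m · δ k n + G m k · δ a n − (2/3)·δ a k · G n m ) = (ρ₀·c_s²·τ₁/6)·( δ i m · δ k n + δ i n · δ k m − (2/3)·δ i k · δ n m ), where δ denotes the Kronecker delta. In other words, in the relaxation limit the implicit stress contribution of the G-J-v subsystem reduces exactly to the compressible Navier–Stokes viscous stress with shear viscosity μ = (1/6)·ρ₀·c_s²·τ₁. -/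
open Matrix

/-- Kronecker delta on `Fin 3`. -/
noncomputable def kdelta (a b : Fin 3) : ℝ := if a = b then 1 else 0

/-- The equilibrium scalar `g = (ρ/ρ₀)^{2/3}` satisfies `ρ g^{-5/2} g = ρ₀`. -/
lemma mul_rpow_equilibrium_metric {ρ ρ₀ : ℝ} (hρ : 0 < ρ) (hρ₀ : 0 < ρ₀) :
    ρ * (((ρ / ρ₀) ^ ((2 : ℝ) / 3)) ^ (-(5 : ℝ) / 2) * (ρ / ρ₀) ^ ((2 : ℝ) / 3)) = ρ₀ := by
  have h : 0 < ρ / ρ₀ := div_pos hρ hρ₀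
  rw [← Real.rpow_mul h.le, ← Real.rpow_add h]
  norm_num [Real.rpow_neg_one]
  field_simp

/-- The inverse of a nonzero scalar matrix. -/
lemma inv_smul_one_of_ne_zero {g : ℝ} (hg : g ≠ 0) :
    (g • (1 : Matrix (Fin 3) (Fin 3) ℝ))⁻¹ = g⁻¹ • (1 : Matrix (Fin 3) (Fin 3) ℝ) :=
  Matrix.inv_eq_right_inv (by simp [smul_smul, hg])

/-- Discrete Navier–Stokes stress tensor identity in the stiff viscous limit:
with the equilibrium metric G = (ρ/ρ₀)^{2/3}•1 and the stiff-limit approximation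
Σ̃⁻¹ = (τ₁/(6Δt))·g^{−5/2}•G⁻¹ of Σ⁻¹, the coefficient tensor of the implicit
velocity wave equation reduces exactly to the compressible Navier–Stokes viscous
stress with shear viscosity μ = (1/6)·ρ₀·c_s²·τ₁. -/
theorem discrete_navier_stokes_stress_limit
    (ρ ρ₀ cs τ₁ Δt : ℝ) (hρ : 0 < ρ) (hρ₀ : 0 < ρ₀) (hcs : 0 < cs)
    (hτ₁ : 0 < τ₁) (hΔt : 0 < Δt) :
    ∀ i k n m : Fin 3,
      let g : ℝ := (ρ / ρ₀) ^ ((2 : ℝ) / 3)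
      let G : Matrix (Fin 3) (Fin 3) ℝ := g • (1 : Matrix (Fin 3) (Fin 3) ℝ)
      let Sinv : Matrix (Fin 3) (Fin 3) ℝ := (τ₁ / (6 * Δt) * g ^ (-(5 : ℝ) / 2)) • G⁻¹
      Δt * ρ * cs ^ 2 *
        ∑ l : Fin 3, ∑ a : Fin 3,
          G i l * Sinv a l *
            (G a m * kdelta k n + G m k * kdelta a n - (2 / 3) * kdelta a k * G n m)
      = (ρ₀ * cs ^ 2 * τ₁ / 6) *
          (kdelta i m * kdelta k n + kdelta i n * kdelta k m
            - (2 / 3) * kdelta i k * kdelta n m) := by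
  intro i k n m g G Sinv
  have hg : g ≠ 0 := (Real.rpow_pos_of_pos (div_pos hρ hρ₀) _).ne'
  have key : ρ * (g ^ (-(5 : ℝ) / 2) * g) = ρ₀ := mul_rpow_equilibrium_metric hρ hρ₀
  have hG : ∀ a b, G a b = g * kdelta a b := fun a b => by
    simp [G, kdelta, Matrix.one_apply]
  have hS : ∀ a b, Sinv a b =
      τ₁ / (6 * Δt) * g ^ (-(5 : ℝ) / 2) * (g⁻¹ * kdelta a b) := fun a b => by
    simp [Sinv, G, inv_smul_one_of_ne_zero hg, kdelta, Matrix.one_apply]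
  have hsymm : ∀ a b, kdelta a b = kdelta b a := fun a b => by simp [kdelta, eq_comm]
  have hsum : ∀ f : Fin 3 → ℝ,
      ∑ l, ∑ a, G i l * Sinv a l * f a = τ₁ / (6 * Δt) * g ^ (-(5 : ℝ) / 2) * f i := by
    intro f
    simp only [hG, hS]
    simp [kdelta]
    left
    field_simp
  rw [hsum, hG, hG, hG, hsymm m k, hsymm n m, ← key]
  field_simp
end
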